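/- Let R ∈ [2√2, 4], let D = {x ∈ ℝ² : 2 ≤ ‖x‖ ≤ R}, and let A ⊂ D be measurable with diam(A) ≤ 2. Then λ₂(A) ≤ R²·arcsin(a/R) − 4·arcsin(a/2) + 2·arccos(a), where a = √((−R⁴ + 16R²)/(8(R² + 2))). -/

import Mathlib

open MeasureTheory

open Set Real

/-- The angles in `(-π, π)` at which the circle of radius `r` about the origin meets `B`. -/
def polarSlice (B : Set (ℝ × ℝ)) (r : ℝ) : Set ℝ :=
  {θ | θ ∈ Ioo (-π) π ∧ (r * cos θ, r * sin θ) ∈ B}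

/-- Circular symmetrization of a planar set about the positive first axis. -/
def circularSymmetrization (B : Set (ℝ × ℝ)) : Set (ℝ × ℝ) :=
  {p | p ∈ polarCoord.source ∧
    |(polarCoord p).2| < (volume (polarSlice B (polarCoord p).1)).toReal / 2}

theorem measurableSet_polar_graph {B : Set (ℝ × ℝ)} (hB : MeasurableSet B) :
    MeasurableSet {p : ℝ × ℝ | p.2 ∈ polarSlice B p.1} := by
  have h : {p : ℝ × ℝ | p.2 ∈ polarSlice B p.1} =
      {p : ℝ × ℝ | p.2 ∈ Ioo (-π) π} ∩ (polarCoord.symm ⁻¹' B) := rfl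
  rw [h]
  exact (measurable_snd measurableSet_Ioo).inter
    (continuous_polarCoord_symm.measurable hB)

theorem measurable_volume_polarSlice {B : Set (ℝ × ℝ)} (hB : MeasurableSet B) :
    Measurable fun r => volume (polarSlice B r) :=
  measurable_measure_prodMk_left (measurableSet_polar_graph hB)

theorem volume_polarSlice_le (B : Set (ℝ × ℝ)) (r : ℝ) :
    volume (polarSlice B r) ≤ ENNReal.ofReal (2 * π) := by
  calc volume (polarSlice B r) ≤ volume (Ioo (-π) π) := measure_mono fun θ h => h.1
    _ = ENNReal.ofReal (2 * π) := by rw [Real.volume_Ioo]; ring_nf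

theorem volume_polarSlice_ne_top (B : Set (ℝ × ℝ)) (r : ℝ) :
    volume (polarSlice B r) ≠ ⊤ :=
  ((volume_polarSlice_le B r).trans_lt ENNReal.ofReal_lt_top).ne

theorem volume_eq_lintegral_polarSlice {B : Set (ℝ × ℝ)} (hB : MeasurableSet B) :
    volume B = ∫⁻ r in Ioi (0 : ℝ), ENNReal.ofReal r * volume (polarSlice B r) := by
  have hind : Measurable (B.indicator (1 : ℝ × ℝ → ENNReal)) := measurable_one.indicator hB
  have hm : Measurable fun p : ℝ × ℝ =>
      ENNReal.ofReal p.1 • B.indicator (1 : ℝ × ℝ → ENNReal) (polarCoord.symm p) :=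
    (ENNReal.measurable_ofReal.comp measurable_fst).mul
      (hind.comp continuous_polarCoord_symm.measurable)
  rw [← lintegral_indicator_one hB, ← lintegral_comp_polarCoord_symm, polarCoord_target,
    Measure.volume_eq_prod, ← Measure.prod_restrict, lintegral_prod _ hm.aemeasurable]
  refine lintegral_congr fun r => ?_
  simp only [smul_eq_mul]
  have hs : Measurable fun θ : ℝ => B.indicator (1 : ℝ × ℝ → ENNReal) (polarCoord.symm (r, θ)) :=
    hind.comp (continuous_polarCoord_symm.measurable.comp measurable_prodMk_left)
  have hsl : MeasurableSet {θ : ℝ | (r * cos θ, r * sin θ) ∈ B} :=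
    (by fun_prop : Measurable fun θ : ℝ => (r * cos θ, r * sin θ)) hB
  rw [lintegral_const_mul _ hs]
  congr 1
  have hi : (fun θ : ℝ => B.indicator (1 : ℝ × ℝ → ENNReal) (polarCoord.symm (r, θ))) =
      {θ : ℝ | (r * cos θ, r * sin θ) ∈ B}.indicator 1 := by
    rfl
  rw [hi, lintegral_indicator_one hsl, Measure.restrict_apply hsl]
  congr 1
  ext θ
  exact and_comm

theorem measurable_polarCoord : Measurable (polarCoord : ℝ × ℝ → ℝ × ℝ) := by
  have h : Measurable fun q : ℝ × ℝ => Complex.arg (Complex.equivRealProd.symm q) :=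
    Complex.measurable_arg.comp Complex.equivRealProdCLM.symm.continuous.measurable
  exact (by fun_prop : Measurable fun q : ℝ × ℝ => √(q.1 ^ 2 + q.2 ^ 2)).prodMk h

theorem measurableSet_circularSymmetrization {B : Set (ℝ × ℝ)} (hB : MeasurableSet B) :
    MeasurableSet (circularSymmetrization B) := by
  have h1 : Measurable fun p : ℝ × ℝ => |(polarCoord p).2| :=
    continuous_abs.measurable.comp (measurable_snd.comp measurable_polarCoord)
  have h2 : Measurable fun p : ℝ × ℝ =>
      (volume (polarSlice B (polarCoord p).1)).toReal / 2 :=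
    ((measurable_volume_polarSlice hB).comp
      (measurable_fst.comp measurable_polarCoord)).ennreal_toReal.div_const 2
  exact polarCoord.open_source.measurableSet.inter (measurableSet_lt h1 h2)

theorem polarSlice_circularSymmetrization (B : Set (ℝ × ℝ)) {r : ℝ} (hr : 0 < r) :
    polarSlice (circularSymmetrization B) r =
      Ioo (-((volume (polarSlice B r)).toReal / 2)) ((volume (polarSlice B r)).toReal / 2) := by
  have hle : (volume (polarSlice B r)).toReal / 2 ≤ π := by
    have := ENNReal.toReal_mono ENNReal.ofReal_ne_top (volume_polarSlice_le B r)
    rw [ENNReal.toReal_ofReal (by positivity)] at this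
    linarith
  ext θ
  have key : θ ∈ Ioo (-π) π → ((r * cos θ, r * sin θ) ∈ circularSymmetrization B ↔
      |θ| < (volume (polarSlice B r)).toReal / 2) := by
    intro hθ
    have ht : (r, θ) ∈ polarCoord.target := ⟨hr, hθ⟩
    have h1 : polarCoord (r * cos θ, r * sin θ) = (r, θ) := polarCoord.right_inv ht
    have h2 : (r * cos θ, r * sin θ) ∈ polarCoord.source := polarCoord.map_target ht
    simp only [circularSymmetrization, mem_ofPred_eq, h1, h2, true_and]
  constructor
  · rintro ⟨h1, h2⟩
    exact abs_lt.1 ((key h1).1 h2)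
  · intro h
    have h1 : θ ∈ Ioo (-π) π := ⟨by linarith [h.1], by linarith [h.2]⟩
    exact ⟨h1, (key h1).2 (abs_lt.2 h)⟩

theorem volume_circularSymmetrization {B : Set (ℝ × ℝ)} (hB : MeasurableSet B) :
    volume (circularSymmetrization B) = volume B := by
  rw [volume_eq_lintegral_polarSlice hB,
    volume_eq_lintegral_polarSlice (measurableSet_circularSymmetrization hB)]
  refine setLIntegral_congr_fun measurableSet_Ioi fun r hr => ?_
  rw [polarSlice_circularSymmetrization B hr, Real.volume_Ioo]
  congr 1
  rw [show ∀ x : ℝ, x / 2 - -(x / 2) = x by intro x; ring,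
    ENNReal.ofReal_toReal (volume_polarSlice_ne_top B r)]

theorem exists_polar_of_mem_circularSymmetrization {B : Set (ℝ × ℝ)} {p : ℝ × ℝ}
    (hp : p ∈ circularSymmetrization B) :
    ∃ r θ : ℝ, 0 < r ∧ p = (r * cos θ, r * sin θ) ∧
      |θ| < (volume (polarSlice B r)).toReal / 2 := by
  refine ⟨(polarCoord p).1, (polarCoord p).2, (polarCoord.map_source hp.1).1, ?_, hp.2⟩
  exact (polarCoord.left_inv hp.1).symm

theorem circularSymmetrization_neg_snd {B : Set (ℝ × ℝ)} {p : ℝ × ℝ}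
    (hp : p ∈ circularSymmetrization B) : (p.1, -p.2) ∈ circularSymmetrization B := by
  obtain ⟨r, θ, hr, rfl, hθ⟩ := exists_polar_of_mem_circularSymmetrization hp
  have h : -θ ∈ polarSlice (circularSymmetrization B) r := by
    rw [polarSlice_circularSymmetrization B hr]
    exact abs_lt.1 (by rwa [abs_neg])
  simpa using h.2

theorem volume_add_volume_le_of_abs_sub_le {E F : Set ℝ} (hE : E.Nonempty) (hF : F.Nonempty)
    {φ : ℝ} (h : ∀ e ∈ E, ∀ f ∈ F, |e - f| ≤ φ) :
    (volume E).toReal + (volume F).toReal ≤ 2 * φ := by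
  obtain ⟨e₀, he₀⟩ := hE
  obtain ⟨f₀, hf₀⟩ := hF
  have bEa : BddAbove E := ⟨f₀ + φ, fun e he => by linarith [(abs_le.1 (h e he f₀ hf₀)).2]⟩
  have bEb : BddBelow E := ⟨f₀ - φ, fun e he => by linarith [(abs_le.1 (h e he f₀ hf₀)).1]⟩
  have bFa : BddAbove F := ⟨e₀ + φ, fun f hf => by linarith [(abs_le.1 (h e₀ he₀ f hf)).1]⟩
  have bFb : BddBelow F := ⟨e₀ - φ, fun f hf => by linarith [(abs_le.1 (h e₀ he₀ f hf)).2]⟩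
  have vol_le : ∀ S : Set ℝ, S.Nonempty → BddAbove S → BddBelow S →
      (volume S).toReal ≤ sSup S - sInf S := by
    intro S hS ha hb
    have h1 : volume S ≤ volume (Icc (sInf S) (sSup S)) :=
      measure_mono fun x hx => ⟨csInf_le hb hx, le_csSup ha hx⟩
    rw [Real.volume_Icc] at h1
    exact ENNReal.toReal_le_of_le_ofReal (sub_nonneg.2 (csInf_le_csSup hS hb ha)) h1
  have h1 : sSup E ≤ sInf F + φ := csSup_le ⟨e₀, he₀⟩ fun e he => by
    have : e - φ ≤ sInf F := le_csInf ⟨f₀, hf₀⟩ fun f hf => by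
      linarith [(abs_le.1 (h e he f hf)).2]
    linarith
  have h2 : sSup F ≤ sInf E + φ := csSup_le ⟨f₀, hf₀⟩ fun f hf => by
    have : f - φ ≤ sInf E := le_csInf ⟨e₀, he₀⟩ fun e he => by
      linarith [(abs_le.1 (h e he f hf)).1]
    linarith
  linarith [vol_le E ⟨e₀, he₀⟩ bEa bEb, vol_le F ⟨f₀, hf₀⟩ bFa bFb]

theorem polar_dist_sq (r s θ η : ℝ) :
    (r * cos θ - s * cos η) ^ 2 + (r * sin θ - s * sin η) ^ 2 =
      r ^ 2 + s ^ 2 - 2 * r * s * cos (θ - η) := by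
  rw [cos_sub]
  linear_combination r ^ 2 * sin_sq_add_cos_sq θ + s ^ 2 * sin_sq_add_cos_sq η

theorem polar_norm_sq (r θ : ℝ) : (r * cos θ) ^ 2 + (r * sin θ) ^ 2 = r ^ 2 := by
  linear_combination r ^ 2 * sin_sq_add_cos_sq θ

theorem abs_le_arccos_of_le_cos {t k : ℝ} (ht : |t| ≤ π) (h : k ≤ cos t) : |t| ≤ arccos k := by
  rw [← arccos_cos (abs_nonneg t) ht, cos_abs]
  exact arccos_le_arccos h

section Annulus

variable {B : Set (ℝ × ℝ)} {ρ : ℝ}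

theorem abs_le_pi_div_three_of_mem_polarSlice
    (hB : ∀ p ∈ B, 4 ≤ p.1 ^ 2 + p.2 ^ 2)
    (hd : ∀ p ∈ B, ∀ q ∈ B, (p.1 - q.1) ^ 2 + (p.2 - q.2) ^ 2 ≤ 4)
    (hρ : 2 ≤ ρ) (hρB : (ρ, 0) ∈ B) {r θ : ℝ} (hr : 0 < r)
    (hθ : θ ∈ polarSlice B r) : |θ| ≤ π / 3 := by
  have h1 := hB _ hθ.2
  have h2 := hd _ hθ.2 _ hρB
  have h3 := polar_dist_sq r ρ θ 0
  simp only [polar_norm_sq] at h1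
  simp only [cos_zero, sin_zero, mul_one, mul_zero, sub_zero] at h2 h3
  have hr2 : 2 ≤ r := by nlinarith
  have hrρ : 4 ≤ r * ρ := by nlinarith
  have hc : 1 / 2 ≤ cos θ := by
    by_contra! hlt
    nlinarith [sq_nonneg (r - ρ)]
  have := abs_le_arccos_of_le_cos (abs_le.2 ⟨hθ.1.1.le, hθ.1.2.le⟩) hc
  rwa [← cos_pi_div_three, arccos_cos (by positivity) (by linarith [pi_pos])] at this

theorem polarSlice_nonempty_of_lt {r θ : ℝ}
    (h : |θ| < (volume (polarSlice B r)).toReal / 2) : (polarSlice B r).Nonempty := by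
  by_contra hne
  rw [not_nonempty_iff_eq_empty.1 hne] at h
  simp only [measure_empty, ENNReal.toReal_zero, zero_div] at h
  exact absurd h (abs_nonneg θ).not_gt

theorem circularSymmetrization_dist_sq_le
    (hB : ∀ p ∈ B, 4 ≤ p.1 ^ 2 + p.2 ^ 2)
    (hd : ∀ p ∈ B, ∀ q ∈ B, (p.1 - q.1) ^ 2 + (p.2 - q.2) ^ 2 ≤ 4)
    (hρ : 2 ≤ ρ) (hρB : (ρ, 0) ∈ B) {p q : ℝ × ℝ}
    (hp : p ∈ circularSymmetrization B) (hq : q ∈ circularSymmetrization B) :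
    (p.1 - q.1) ^ 2 + (p.2 - q.2) ^ 2 ≤ 4 := by
  obtain ⟨r, θ, hr, rfl, hθ⟩ := exists_polar_of_mem_circularSymmetrization hp
  obtain ⟨s, η, hs, rfl, hη⟩ := exists_polar_of_mem_circularSymmetrization hq
  have hE := polarSlice_nonempty_of_lt hθ
  have hF := polarSlice_nonempty_of_lt hη
  set k := (r ^ 2 + s ^ 2 - 4) / (2 * r * s) with hk
  have hrs : 0 < 2 * r * s := by positivity
  have hcos : ∀ e ∈ polarSlice B r, ∀ f ∈ polarSlice B s, k ≤ cos (e - f) := by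
    intro e he f hf
    have h := hd _ he.2 _ hf.2
    simp only [polar_dist_sq] at h
    rw [hk, div_le_iff₀ hrs]
    linarith
  have habs : ∀ e ∈ polarSlice B r, ∀ f ∈ polarSlice B s, |e - f| ≤ arccos k := by
    intro e he f hf
    refine abs_le_arccos_of_le_cos ?_ (hcos e he f hf)
    have h1 := abs_le_pi_div_three_of_mem_polarSlice hB hd hρ hρB hr he
    have h2 := abs_le_pi_div_three_of_mem_polarSlice hB hd hρ hρB hs hf
    linarith [abs_sub e f, pi_pos]
  have hsum := volume_add_volume_le_of_abs_sub_le hE hF habs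
  have hdiff : |θ - η| ≤ arccos k := by linarith [abs_sub θ η]
  obtain ⟨e, he⟩ := hE
  obtain ⟨f, hf⟩ := hF
  have hk1 : k ≤ 1 := (hcos e he f hf).trans (cos_le_one _)
  have hk0 : -1 ≤ k := by
    have h1 := hB _ he.2
    have h2 := hB _ hf.2
    simp only [polar_norm_sq] at h1 h2
    have : 0 ≤ k := div_nonneg (by linarith) hrs.le
    linarith
  have hfin : k ≤ cos (θ - η) := by
    rw [← cos_abs (θ - η)]
    calc k = cos (arccos k) := (cos_arccos hk0 hk1).symm
      _ ≤ _ := cos_le_cos_of_nonneg_of_le_pi (abs_nonneg _) (arccos_le_pi k) hdiff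
  rw [hk, div_le_iff₀ hrs] at hfin
  simp only [polar_dist_sq]
  linarith

theorem circularSymmetrization_fst_pos
    (hB : ∀ p ∈ B, 4 ≤ p.1 ^ 2 + p.2 ^ 2)
    (hd : ∀ p ∈ B, ∀ q ∈ B, (p.1 - q.1) ^ 2 + (p.2 - q.2) ^ 2 ≤ 4)
    (hρ : 2 ≤ ρ) (hρB : (ρ, 0) ∈ B) {p : ℝ × ℝ}
    (hp : p ∈ circularSymmetrization B) : 0 < p.1 := by
  obtain ⟨r, θ, hr, rfl, hθ⟩ := exists_polar_of_mem_circularSymmetrization hp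
  have hE := polarSlice_nonempty_of_lt hθ
  have hbound : ∀ e ∈ polarSlice B r, ∀ f ∈ ({0} : Set ℝ), |e - f| ≤ π / 3 := by
    rintro e he f rfl
    simpa using abs_le_pi_div_three_of_mem_polarSlice hB hd hρ hρB hr he
  have h := volume_add_volume_le_of_abs_sub_le hE (singleton_nonempty 0) hbound
  simp only [measure_singleton, ENNReal.toReal_zero, add_zero] at h
  have h' := abs_lt.1 hθ
  exact mul_pos hr (cos_pos_of_mem_Ioo ⟨by linarith [pi_pos], by linarith [pi_pos]⟩)

theorem circularSymmetrization_norm_sq {P : ℝ → Prop}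
    (hB : ∀ p ∈ B, P (p.1 ^ 2 + p.2 ^ 2)) {p : ℝ × ℝ}
    (hp : p ∈ circularSymmetrization B) : P (p.1 ^ 2 + p.2 ^ 2) := by
  obtain ⟨r, θ, hr, rfl, hθ⟩ := exists_polar_of_mem_circularSymmetrization hp
  obtain ⟨e, he⟩ := polarSlice_nonempty_of_lt hθ
  have := hB _ he.2
  simp only [polar_norm_sq] at this ⊢
  exact this

end Annulus

/-- A primitive of `y ↦ √(r ^ 2 - y ^ 2)`. -/
noncomputable def diskPrimitive (r y : ℝ) : ℝ :=
  (r ^ 2 * arcsin (y / r) + y * √(r ^ 2 - y ^ 2)) / 2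

theorem hasDerivAt_diskPrimitive {r y : ℝ} (hr : 0 < r) (h1 : -r < y) (h2 : y < r) :
    HasDerivAt (diskPrimitive r) (√(r ^ 2 - y ^ 2)) y := by
  have hpos : 0 < r ^ 2 - y ^ 2 := by nlinarith
  have hs : 0 < √(r ^ 2 - y ^ 2) := sqrt_pos.2 hpos
  have hsq : √(r ^ 2 - y ^ 2) ^ 2 = r ^ 2 - y ^ 2 := sq_sqrt hpos.le
  have hd1 : HasDerivAt (fun y => y / r) (1 / r) y := (hasDerivAt_id y).div_const r
  have hn1 : y / r ≠ -1 := by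
    rw [Ne, div_eq_iff hr.ne']; intro h; linarith
  have hn2 : y / r ≠ 1 := by
    rw [Ne, div_eq_iff hr.ne']; intro h; linarith
  have hd2 := (hasDerivAt_arcsin hn1 hn2).comp y hd1
  have hd3 : HasDerivAt (fun y => r ^ 2 - y ^ 2) (-(2 * y)) y := by
    simpa using (hasDerivAt_pow 2 y).const_sub (r ^ 2)
  have hd4 := (hasDerivAt_id y).mul (hd3.sqrt hpos.ne')
  have hd := ((hd2.const_mul (r ^ 2)).add hd4).div_const 2
  refine hd.congr_deriv ?_
  have hr' : √(1 - (y / r) ^ 2) = √(r ^ 2 - y ^ 2) / r := by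
    rw [show 1 - (y / r) ^ 2 = (r ^ 2 - y ^ 2) / r ^ 2 by field_simp,
      sqrt_div hpos.le, sqrt_sq hr.le]
  rw [hr']
  simp only [id]
  field_simp
  linear_combination -hsq

theorem continuous_diskPrimitive (r : ℝ) : Continuous (diskPrimitive r) := by
  unfold diskPrimitive
  have : Continuous fun y : ℝ => arcsin (y / r) :=
    continuous_arcsin.comp (continuous_id.div_const r)
  fun_prop

theorem integral_sqrt_sq_sub_sq {r b c : ℝ} (hr : 0 < r) (hb : -r ≤ b) (hbc : b ≤ c)
    (hc : c ≤ r) :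
    ∫ y in b..c, √(r ^ 2 - y ^ 2) = diskPrimitive r c - diskPrimitive r b := by
  refine intervalIntegral.integral_eq_sub_of_hasDerivAt_of_le hbc
    (continuous_diskPrimitive r).continuousOn
    (fun y hy => hasDerivAt_diskPrimitive hr (by linarith [hy.1]) (by linarith [hy.2])) ?_
  exact (by fun_prop : Continuous fun y : ℝ => √(r ^ 2 - y ^ 2)).intervalIntegrable _ _

theorem diskPrimitive_neg (r y : ℝ) : diskPrimitive r (-y) = -diskPrimitive r y := by
  simp only [diskPrimitive, neg_div, arcsin_neg]
  ring_nf

theorem lintegral_Icc_le_of_le_ofReal {f : ℝ → ENNReal} {g : ℝ → ℝ} {b c : ℝ} (hbc : b ≤ c)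
    (hg : Continuous g) (hg0 : ∀ y ∈ Icc b c, 0 ≤ g y)
    (h : ∀ y ∈ Icc b c, f y ≤ ENNReal.ofReal (g y)) :
    ∫⁻ y in Icc b c, f y ≤ ENNReal.ofReal (∫ y in b..c, g y) := by
  rw [intervalIntegral.integral_of_le hbc, ← integral_Icc_eq_integral_Ioc,
    ofReal_integral_eq_lintegral_ofReal hg.integrableOn_Icc
      ((ae_restrict_iff' measurableSet_Icc).2 (Filter.Eventually.of_forall hg0))]
  exact setLIntegral_mono' measurableSet_Icc h

theorem volume_le_of_symmetric {C : Set (ℝ × ℝ)} (hC : MeasurableSet C) {R a : ℝ}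
    (hR : 2 ≤ R) (ha0 : 0 ≤ a) (ha1 : a ≤ 1)
    (haR : √(R ^ 2 - a ^ 2) - √(2 ^ 2 - a ^ 2) = 2 * √(1 ^ 2 - a ^ 2))
    (hsymm : ∀ p ∈ C, (p.1, -p.2) ∈ C)
    (hpos : ∀ p ∈ C, 0 < p.1)
    (hnorm : ∀ p ∈ C, 2 ^ 2 ≤ p.1 ^ 2 + p.2 ^ 2 ∧ p.1 ^ 2 + p.2 ^ 2 ≤ R ^ 2)
    (hd : ∀ p ∈ C, ∀ q ∈ C, (p.1 - q.1) ^ 2 + (p.2 - q.2) ^ 2 ≤ 4) :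
    volume C ≤ ENNReal.ofReal
      (R ^ 2 * arcsin (a / R) - 4 * arcsin (a / 2) + 2 * arccos a) := by
  have hchord : ∀ y x x', (x, y) ∈ C → (x', y) ∈ C → (x - x') ^ 2 ≤ 4 * (1 - y ^ 2) := by
    intro y x x' hx hx'
    have := hd _ hx _ (hsymm _ hx')
    simp only at this
    linarith
  have hdisk : ∀ y, volume ((fun x => (x, y)) ⁻¹' C) ≤ ENNReal.ofReal (2 * √(1 ^ 2 - y ^ 2)) := by
    intro y
    refine (Real.volume_le_diam _).trans (Metric.ediam_le fun x hx x' hx' => ?_)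
    rw [edist_dist, Real.dist_eq]
    refine ENNReal.ofReal_le_ofReal ?_
    rw [← sqrt_sq (show (0 : ℝ) ≤ 2 by norm_num), ← sqrt_mul (by positivity)]
    refine abs_le_sqrt ?_
    linarith [hchord y x x' hx hx']
  have hann : ∀ y, volume ((fun x => (x, y)) ⁻¹' C) ≤
      ENNReal.ofReal (√(R ^ 2 - y ^ 2) - √(2 ^ 2 - y ^ 2)) := by
    intro y
    rw [← Real.volume_Icc]
    refine measure_mono fun x hx => ?_
    obtain ⟨h1, h2⟩ := hnorm _ hx
    have h0 := hpos _ hx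
    simp only at h0 h1 h2
    exact ⟨sqrt_le_iff.2 ⟨h0.le, by linarith⟩, le_sqrt_of_sq_le (by linarith)⟩
  have hout : ∀ y, y ∉ Icc (-1 : ℝ) 1 → volume ((fun x => (x, y)) ⁻¹' C) = 0 := by
    intro y hy
    have hempty : (fun x => (x, y)) ⁻¹' C = ∅ := by
      refine eq_empty_of_forall_notMem fun x hx => hy ?_
      have := hchord y x x hx hx
      exact abs_le.1 ((sq_le_one_iff_abs_le_one y).1 (by linarith))
    rw [hempty, measure_empty]
  have hcd : Continuous fun y : ℝ => 2 * √(1 ^ 2 - y ^ 2) := by fun_prop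
  have hca : Continuous fun y : ℝ => √(R ^ 2 - y ^ 2) - √(2 ^ 2 - y ^ 2) := by fun_prop
  have hann0 : ∀ y, 0 ≤ √(R ^ 2 - y ^ 2) - √(2 ^ 2 - y ^ 2) := fun y =>
    sub_nonneg.2 (sqrt_le_sqrt (by nlinarith))
  have hI1 := lintegral_Icc_le_of_le_ofReal (b := -1) (c := -a) (by linarith) hcd
    (fun y _ => by positivity) fun y _ => hdisk y
  have hI2 := lintegral_Icc_le_of_le_ofReal (b := -a) (c := a) (by linarith) hca
    (fun y _ => hann0 y) fun y _ => hann y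
  have hI3 := lintegral_Icc_le_of_le_ofReal (b := a) (c := 1) ha1 hcd
    (fun y _ => by positivity) fun y _ => hdisk y
  have hcover : Icc (-1 : ℝ) 1 ⊆ Icc (-1) (-a) ∪ Icc (-a) a ∪ Icc a 1 := by
    intro y hy
    rcases le_total y (-a) with h | h
    · exact Or.inl (Or.inl ⟨hy.1, h⟩)
    rcases le_total y a with h' | h'
    · exact Or.inl (Or.inr ⟨h, h'⟩)
    · exact Or.inr ⟨h', hy.2⟩
  have hintd : ∀ b c, -1 ≤ b → b ≤ c → c ≤ 1 → ∫ y in b..c, 2 * √(1 ^ 2 - y ^ 2) =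
      2 * (diskPrimitive 1 c - diskPrimitive 1 b) := by
    intro b c hb hbc hc
    rw [intervalIntegral.integral_const_mul, integral_sqrt_sq_sub_sq one_pos hb hbc hc]
  have hinta : ∫ y in (-a)..a, (√(R ^ 2 - y ^ 2) - √(2 ^ 2 - y ^ 2)) =
      2 * diskPrimitive R a - 2 * diskPrimitive 2 a := by
    rw [intervalIntegral.integral_sub
      ((by fun_prop : Continuous fun y : ℝ => √(R ^ 2 - y ^ 2)).intervalIntegrable _ _)
      ((by fun_prop : Continuous fun y : ℝ => √(2 ^ 2 - y ^ 2)).intervalIntegrable _ _),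
      integral_sqrt_sq_sub_sq (by linarith) (by linarith) (by linarith) (by linarith),
      integral_sqrt_sq_sub_sq (by linarith) (by linarith) (by linarith) (by linarith),
      diskPrimitive_neg, diskPrimitive_neg]
    ring
  have hn1 : 0 ≤ ∫ y in (-1)..(-a), 2 * √(1 ^ 2 - y ^ 2) :=
    intervalIntegral.integral_nonneg (by linarith) fun y _ => by positivity
  have hn2 : 0 ≤ ∫ y in (-a)..a, (√(R ^ 2 - y ^ 2) - √(2 ^ 2 - y ^ 2)) :=
    intervalIntegral.integral_nonneg (by linarith) fun y _ => hann0 y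
  have hn3 : 0 ≤ ∫ y in a..1, 2 * √(1 ^ 2 - y ^ 2) :=
    intervalIntegral.integral_nonneg ha1 fun y _ => by positivity
  calc volume C = ∫⁻ y, volume ((fun x => (x, y)) ⁻¹' C) := by
        rw [Measure.volume_eq_prod, Measure.prod_apply_symm hC]
    _ = ∫⁻ y in Icc (-1 : ℝ) 1, volume ((fun x => (x, y)) ⁻¹' C) :=
        (setLIntegral_eq_of_support_subset fun y hy => by
          by_contra h
          exact hy (hout y h)).symm
    _ ≤ ∫⁻ y in Icc (-1) (-a) ∪ Icc (-a) a ∪ Icc a 1, volume ((fun x => (x, y)) ⁻¹' C) :=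
        lintegral_mono_set hcover
    _ ≤ _ := (lintegral_union_le _ _ _).trans (add_le_add_left (lintegral_union_le _ _ _) _)
    _ ≤ _ := add_le_add (add_le_add hI1 hI2) hI3
    _ = _ := by
        rw [← ENNReal.ofReal_add hn1 hn2, ← ENNReal.ofReal_add (add_nonneg hn1 hn2) hn3,
          hintd _ _ le_rfl (by linarith) (by linarith), hintd _ _ (by linarith) ha1 le_rfl, hinta,
          diskPrimitive_neg, diskPrimitive_neg]
        congr 1
        simp only [diskPrimitive, arccos, div_one, arcsin_one]
        norm_num at haR ⊢
        linear_combination a * haR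

theorem sqrt_annulus_sub {R a : ℝ} (hR2 : 2 ≤ R) (hR4 : R ≤ 4)
    (ha : a = √((-R ^ 4 + 16 * R ^ 2) / (8 * (R ^ 2 + 2)))) :
    a ≤ 1 ∧ √(R ^ 2 - a ^ 2) - √(2 ^ 2 - a ^ 2) = 2 * √(1 ^ 2 - a ^ 2) := by
  have hR16 : R ^ 2 ≤ 16 := by nlinarith
  have hR4' : 4 ≤ R ^ 2 := by nlinarith
  have hsq : a ^ 2 = (-R ^ 4 + 16 * R ^ 2) / (8 * (R ^ 2 + 2)) := by
    rw [ha, sq_sqrt]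
    exact div_nonneg (by nlinarith) (by positivity)
  have hrel : a ^ 2 * (8 * (R ^ 2 + 2)) = -R ^ 4 + 16 * R ^ 2 := by
    rw [hsq, div_mul_cancel₀ _ (by positivity)]
  have ha1 : a ^ 2 ≤ 1 := by
    rw [hsq, div_le_one (by positivity)]
    nlinarith [sq_nonneg (R ^ 2 - 4)]
  refine ⟨by nlinarith, ?_⟩
  have hprod : √(R ^ 2 - a ^ 2) * √(2 ^ 2 - a ^ 2) = (R ^ 2 + 2 * a ^ 2) / 2 := by
    rw [← sqrt_mul (by linarith), sqrt_eq_iff_mul_self_eq_of_pos (by positivity)]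
    linear_combination (1 / 4) * hrel
  have hle : √(2 ^ 2 - a ^ 2) ≤ √(R ^ 2 - a ^ 2) := sqrt_le_sqrt (by linarith)
  have e1 : √(R ^ 2 - a ^ 2) ^ 2 = R ^ 2 - a ^ 2 := sq_sqrt (by linarith)
  have e2 : √(2 ^ 2 - a ^ 2) ^ 2 = 2 ^ 2 - a ^ 2 := sq_sqrt (by linarith)
  have e3 : √(1 ^ 2 - a ^ 2) ^ 2 = 1 ^ 2 - a ^ 2 := sq_sqrt (by linarith)
  refine (sq_eq_sq₀ (sub_nonneg.2 hle) (by positivity)).1 ?_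
  linear_combination e1 + e2 - 4 * e3 - 2 * hprod

theorem exists_planar_copy {A : Set (EuclideanSpace ℝ (Fin 2))} (hA : MeasurableSet A)
    {x₀ : EuclideanSpace ℝ (Fin 2)} (hx₀ : x₀ ∈ A) :
    ∃ B : Set (ℝ × ℝ), MeasurableSet B ∧ volume B = volume A ∧ (‖x₀‖, 0) ∈ B ∧
      ∃ f : ℝ × ℝ → EuclideanSpace ℝ (Fin 2), (∀ p ∈ B, f p ∈ A) ∧
        (∀ p, ‖f p‖ ^ 2 = p.1 ^ 2 + p.2 ^ 2) ∧
        ∀ p q, dist (f p) (f q) ^ 2 = (p.1 - q.1) ^ 2 + (p.2 - q.2) ^ 2 := by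
  set e := Complex.orthonormalBasisOneI.repr
  set z₀ := e.symm x₀ with hz₀
  set g := (rotation (Circle.exp (Complex.arg z₀))).trans e with hg
  have hmp : MeasurePreserving (fun p => g (Complex.measurableEquivRealProd.symm p)) :=
    g.measurePreserving.comp (Complex.volume_preserving_equiv_real_prod.symm)
  have hnorm : ∀ p : ℝ × ℝ,
      ‖g (Complex.measurableEquivRealProd.symm p)‖ ^ 2 = p.1 ^ 2 + p.2 ^ 2 := by
    intro p
    rw [g.norm_map, Complex.sq_norm, Complex.normSq_apply]
    simp [Complex.measurableEquivRealProd]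
    ring
  refine ⟨(fun p => g (Complex.measurableEquivRealProd.symm p)) ⁻¹' A, hmp.measurable hA,
    hmp.measure_preimage hA.nullMeasurableSet, ?_, _, fun p hp => hp, hnorm, fun p q => ?_⟩
  · have hpt : Complex.measurableEquivRealProd.symm (‖x₀‖, 0) = (‖z₀‖ : ℂ) := by
      rw [hz₀, e.symm.norm_map]
      apply Complex.ext <;> simp [Complex.measurableEquivRealProd]
    have : g (‖z₀‖ : ℂ) = x₀ := by
      rw [hg, LinearIsometryEquiv.trans_apply, rotation_apply, Circle.coe_exp, mul_comm,
        Complex.norm_mul_exp_arg_mul_I, hz₀, e.apply_symm_apply]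
    rw [mem_preimage, hpt, this]
    exact hx₀
  · have hsub : Complex.measurableEquivRealProd.symm p - Complex.measurableEquivRealProd.symm q =
        Complex.measurableEquivRealProd.symm (p - q) := by
      apply Complex.ext <;> simp [Complex.measurableEquivRealProd]
    rw [dist_eq_norm, ← map_sub, hsub, hnorm]
    rfl

theorem stmt6 (R : ℝ) (hR : R ∈ Set.Icc (2 * Real.sqrt 2) 4)
    (a : ℝ) (ha : a = Real.sqrt ((-R ^ 4 + 16 * R ^ 2) / (8 * (R ^ 2 + 2))))
    (A : Set (EuclideanSpace ℝ (Fin 2))) (hA : MeasurableSet A)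
    (hAD : A ⊆ {x : EuclideanSpace ℝ (Fin 2) | 2 ≤ ‖x‖ ∧ ‖x‖ ≤ R})
    (hdiam : EMetric.diam A ≤ 2) :
    volume A ≤ ENNReal.ofReal
      (R ^ 2 * Real.arcsin (a / R) - 4 * Real.arcsin (a / 2) + 2 * Real.arccos a) := by
  rcases A.eq_empty_or_nonempty with rfl | ⟨x₀, hx₀⟩
  · simp
  have hR2 : 2 ≤ R := by
    have : (1 : ℝ) ≤ √2 := one_le_sqrt.2 (by norm_num)
    linarith [hR.1]
  obtain ⟨ha1, haR⟩ := sqrt_annulus_sub hR2 hR.2 ha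
  obtain ⟨B, hB, hvol, hB₀, f, hf, hnorm, hdist⟩ := exists_planar_copy hA hx₀
  have hBn : ∀ p ∈ B, 4 ≤ p.1 ^ 2 + p.2 ^ 2 ∧ p.1 ^ 2 + p.2 ^ 2 ≤ R ^ 2 := by
    intro p hp
    obtain ⟨h1, h2⟩ := hAD (hf p hp)
    rw [← hnorm p]
    constructor <;> nlinarith
  have hBd : ∀ p ∈ B, ∀ q ∈ B, (p.1 - q.1) ^ 2 + (p.2 - q.2) ^ 2 ≤ 4 := by
    intro p hp q hq
    have h := (Metric.edist_le_ediam_of_mem (hf p hp) (hf q hq)).trans hdiam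
    rw [edist_dist, ENNReal.ofReal_le_ofNat] at h
    rw [← hdist p q]
    nlinarith [dist_nonneg (x := f p) (y := f q)]
  have hlow : ∀ p ∈ B, 4 ≤ p.1 ^ 2 + p.2 ^ 2 := fun p hp => (hBn p hp).1
  have hρ : 2 ≤ ‖x₀‖ := (hAD hx₀).1
  rw [← hvol, ← volume_circularSymmetrization hB]
  refine volume_le_of_symmetric (measurableSet_circularSymmetrization hB) hR2
    (ha ▸ sqrt_nonneg _) ha1 haR (fun p hp => circularSymmetrization_neg_snd hp)
    (fun p hp => circularSymmetrization_fst_pos hlow hBd hρ hB₀ hp) (fun p hp => ?_)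
    (fun p hp q hq => circularSymmetrization_dist_sq_le hlow hBd hρ hB₀ hp hq)
  have := circularSymmetrization_norm_sq (P := fun t => 4 ≤ t ∧ t ≤ R ^ 2) hBn hp
  norm_num
  exact this
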